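/- For every natural number n ≥ 1, the sum over all q in the Farey set F_n of the denominator of q (in lowest terms) equals two times the sum over all q in F_n of the numerator of q (in lowest terms). -/

import Mathlib

theorem Rat.den_one_sub (q : ℚ) : (1 - q).den = q.den :=
  mod_cast Rat.natCast_sub_den 1 q

theorem Rat.num_one_sub (q : ℚ) : (1 - q).num = q.den - q.num := by
  have h : ((1 - q).num : ℚ) = q.den - q.num := by
    rw [← Rat.mul_den_eq_num (1 - q), Rat.den_one_sub, sub_mul, one_mul, Rat.mul_den_eq_num]
  exact_mod_cast h

/-- For `n ≥ 1`, in the Farey set `F_n` the sum of denominators is twice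
the sum of numerators. -/
theorem farey_den_sum_eq_two_mul_num_sum (n : ℕ) (hn : 1 ≤ n) (F : Finset ℚ)
    (hF : ∀ q : ℚ, q ∈ F ↔ 0 ≤ q ∧ q ≤ 1 ∧ q.den ≤ n) :
    (∑ q ∈ F, (q.den : ℤ)) = 2 * ∑ q ∈ F, q.num := by
  have hmem : ∀ q ∈ F, 1 - q ∈ F := fun q hq ↦ by
    obtain ⟨h0, h1, hd⟩ := (hF q).1 hq
    exact (hF _).2 ⟨sub_nonneg.2 h1, sub_le_self 1 h0, (Rat.den_one_sub q).trans_le hd⟩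
  have hsum : ∑ q ∈ F, q.num = ∑ q ∈ F, ((q.den : ℤ) - q.num) :=
    Finset.sum_nbij' (1 - ·) (1 - ·) hmem hmem (fun q _ ↦ sub_sub_cancel 1 q)
      (fun q _ ↦ sub_sub_cancel 1 q) fun q _ ↦ by
        rw [Rat.num_one_sub, Rat.den_one_sub, sub_sub_cancel]
  rw [Finset.sum_sub_distrib] at hsum
  linarith
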